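/- arXiv:1908.05963 — 3 statements merged into one kernel-verified Lean document; each statement's English description precedes it below -/
import Mathlib

section
/- Let g be a finite-dimensional complex Lie algebra that is sympathetic, i.e. g is perfect (⁅g, g⁆ = g) and complete (the center Z(g) is trivial and every derivation of g is inner). If the solvable radical r of g is abelian, then g is semisimple. -/
open LieAlgebra

section
attribute [local instance 100] LieRing.ofAssociativeRing
variable {L : Type*} [LieRing L] [LieAlgebra ℂ L]

lemma q_identity (p : L →ₗ[ℂ] L) (x y e : L) :
    ⁅x, p ⁅e, y⁆ - ⁅p e, y⁆⁆ - (p ⁅⁅x, e⁆, y⁆ - ⁅p ⁅x, e⁆, y⁆)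
    - (⁅y, p ⁅e, x⁆ - ⁅p e, x⁆⁆ - (p ⁅⁅y, e⁆, x⁆ - ⁅p ⁅y, e⁆, x⁆))
    - (p ⁅e, ⁅x, y⁆⁆ - ⁅p e, ⁅x, y⁆⁆) = 0 := by
  have h1 : p ⁅e, ⁅x, y⁆⁆ = p ⁅⁅y, e⁆, x⁆ - p ⁅⁅x, e⁆, y⁆ := by
    rw [← map_sub]; congr 1
    have a1 : ⁅e, y⁆ = -⁅y, e⁆ := (lie_skew e y).symm
    have a2 : ⁅e, x⁆ = -⁅x, e⁆ := (lie_skew e x).symm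
    have a3 : ⁅x, ⁅y, e⁆⁆ = -⁅⁅y, e⁆, x⁆ := (lie_skew _ _).symm
    rw [leibniz_lie e x y, a1, a2, lie_neg, neg_lie, a3]
    abel
  have h2 : ⁅p e, ⁅x, y⁆⁆ = - ⁅y, ⁅p e, x⁆⁆ + ⁅x, ⁅p e, y⁆⁆ := by
    rw [leibniz_lie (p e) x y, lie_skew]
  have h3 : ⁅p ⁅x, e⁆, y⁆ = ⁅y, p ⁅e, x⁆⁆ := by
    have a2 : ⁅e, x⁆ = -⁅x, e⁆ := (lie_skew e x).symm
    rw [← lie_skew, a2, map_neg, lie_neg]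
  have h4 : ⁅p ⁅y, e⁆, x⁆ = ⁅x, p ⁅e, y⁆⁆ := by
    have a2 : ⁅e, y⁆ = -⁅y, e⁆ := (lie_skew e y).symm
    rw [← lie_skew, a2, map_neg, lie_neg]
  rw [h1, h2, h3, h4, lie_sub, lie_sub]; abel

/-- the Casimir operator twisted by a projection -/
noncomputable def casD {ι : Type*} [Fintype ι] (e f : ι → L) (p : L →ₗ[ℂ] L) : L →ₗ[ℂ] L :=
  ∑ i, (ad ℂ L (e i)).comp (p.comp (ad ℂ L (f i)) - ad ℂ L (p (f i)))

lemma casD_apply {ι : Type*} [Fintype ι] (e f : ι → L) (p : L →ₗ[ℂ] L) (x : L) :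
    casD e f p x = ∑ i, ⁅e i, p ⁅f i, x⁆ - ⁅p (f i), x⁆⁆ := by
  simp [casD, LinearMap.sum_apply]

/-- bilinear form version -/
noncomputable def casF (p : L →ₗ[ℂ] L) (y : L) : L →ₗ[ℂ] L →ₗ[ℂ] L :=
  (LinearMap.lcomp ℂ L ((p.comp (ad ℂ L y)) - (ad ℂ L y).comp p)).comp
    (ad ℂ L : L →ₗ[ℂ] Module.End ℂ L)

lemma casF_apply (p : L →ₗ[ℂ] L) (y u v : L) :
    casF p y u v = - ⁅u, p ⁅v, y⁆ - ⁅p v, y⁆⁆ := by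
  simp only [casF, LinearMap.comp_apply, LinearMap.lcomp_apply, LinearMap.sub_apply, ad_apply,
    LieHom.coe_toLinearMap]
  have a1 : ⁅v, y⁆ = -⁅y, v⁆ := (lie_skew _ _).symm
  have a2 : ⁅p v, y⁆ = -⁅y, p v⁆ := (lie_skew _ _).symm
  rw [a1, a2, map_neg, ← lie_neg]; congr 1; abel

lemma inv_bilin {ι : Type*} [Fintype ι] (R : LieIdeal ℂ L) (e f : ι → L) (x : L)
    (a : ι → ι → ℂ) (h1 : ∀ i, ⁅x, e i⁆ - ∑ j, a i j • e j ∈ R)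
    (h2 : ∀ i, ⁅x, f i⁆ + ∑ j, a j i • f j ∈ R) (F : L →ₗ[ℂ] L →ₗ[ℂ] L)
    (hF1 : ∀ r ∈ R, ∀ i, F r (f i) = 0) (hF2 : ∀ r ∈ R, ∀ i, F (e i) r = 0) :
    ∑ i, (F ⁅x, e i⁆ (f i) + F (e i) ⁅x, f i⁆) = 0 := by
  have k1 : ∀ i, F ⁅x, e i⁆ (f i) = ∑ j, a i j • F (e j) (f i) := fun i => by
    have := hF1 _ (h1 i) i
    rw [map_sub, LinearMap.sub_apply, sub_eq_zero] at this
    rw [this]; simp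
  have k2 : ∀ i, F (e i) ⁅x, f i⁆ = - ∑ j, a j i • F (e i) (f j) := fun i => by
    have := hF2 _ (h2 i) i
    rw [map_add, add_eq_zero_iff_eq_neg] at this
    rw [this]; simp
  simp only [k1, k2, Finset.sum_add_distrib, Finset.sum_neg_distrib]
  rw [Finset.sum_comm]; simp

lemma casD_leibniz {ι : Type*} [Fintype ι] (R : LieIdeal ℂ L)
    (hR : ∀ r ∈ R, ∀ s ∈ R, ⁅r, s⁆ = 0) (e f : ι → L)
    (hinv : ∀ x : L, ∃ a : ι → ι → ℂ, (∀ i, ⁅x, e i⁆ - ∑ j, a i j • e j ∈ R) ∧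
      (∀ i, ⁅x, f i⁆ + ∑ j, a j i • f j ∈ R))
    (p : L →ₗ[ℂ] L) (hp : ∀ x, p x ∈ R) (hp' : ∀ x ∈ R, p x = x) (x y : L) :
    casD e f p ⁅x, y⁆ = ⁅x, casD e f p y⁆ - ⁅y, casD e f p x⁆ := by
  have key : ∀ x y : L, ⁅x, casD e f p y⁆ = ∑ i, ⁅e i, ⁅x, p ⁅f i, y⁆ - ⁅p (f i), y⁆⁆ -
      (p ⁅⁅x, f i⁆, y⁆ - ⁅p ⁅x, f i⁆, y⁆)⁆ := by
    intro x y
    obtain ⟨a, h1, h2⟩ := hinv x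
    have := inv_bilin R e f x a h1 h2 (casF p y) (fun r hr i => by
      rw [casF_apply, hR _ hr, neg_zero]
      exact sub_mem (hp _) (lie_mem_left ℂ L R _ _ (hp _))) (fun r hr i => by
      rw [casF_apply, hp' r hr, hp' _ (lie_mem_left ℂ L R _ _ hr)]; simp)
    rw [casD_apply, lie_sum, ← add_zero (∑ i, ⁅x, ⁅e i, p ⁅f i, y⁆ - ⁅p (f i), y⁆⁆⁆), ← this, ← Finset.sum_add_distrib]
    refine Finset.sum_congr rfl fun i _ => ?_
    rw [casF_apply, casF_apply, leibniz_lie x (e i), lie_sub (e i) ⁅x, p ⁅f i, y⁆ - ⁅p (f i), y⁆⁆]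
    abel
  rw [key, key, casD_apply, ← sub_eq_zero, ← Finset.sum_sub_distrib, ← Finset.sum_sub_distrib]
  refine Finset.sum_eq_zero fun i _ => ?_
  rw [← lie_sub, ← lie_sub]
  have := q_identity p x y (f i)
  rw [sub_eq_zero] at this
  rw [← this, sub_self, lie_zero]

variable [FiniteDimensional ℂ L]

lemma trace_zero_of_perfect (hperf : ⁅(⊤ : LieIdeal ℂ L), (⊤ : LieIdeal ℂ L)⁆ = ⊤)
    (R : LieIdeal ℂ L) (x : L) :
    LinearMap.trace ℂ R (LieModule.toEnd ℂ L R x) = 0 := by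
  have hx : x ∈ (⁅(⊤ : LieIdeal ℂ L), (⊤ : LieIdeal ℂ L)⁆).toSubmodule := by rw [hperf]; trivial
  rw [LieSubmodule.lieIdeal_oper_eq_linear_span'] at hx
  induction hx using Submodule.span_induction with
  | mem x h =>
    obtain ⟨a, -, b, -, rfl⟩ := h
    rw [LieHom.map_lie, LieRing.of_associative_ring_bracket, map_sub, LinearMap.trace_mul_comm,
      sub_self]
  | zero => simp
  | add x y _ _ h1 h2 => simp [h1, h2]
  | smul a x _ h => simp [h]

lemma exists_J (R K : LieIdeal ℂ L) (hRad : R = radical ℂ L) (hab : IsLieAbelian R)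
    (hRK : R ≤ K) :
    ∃ J : LieIdeal ℂ L, R ≤ J ∧ J ⊓ K ≤ R ∧ J.toSubmodule ⊔ K.toSubmodule = ⊤ := by
  have hker : LieIdeal.killingCompl ℂ L ⊤ = R := by
    apply le_antisymm
    · rw [hRad]; exact killingCompl_top_le_radical ℂ L
    · exact LieIdeal.le_killingCompl_top_of_isLieAbelian ℂ L R
  have hRJ : R ≤ LieIdeal.killingCompl ℂ L K := by
    intro x hx
    rw [← hker] at hx
    rw [LieIdeal.mem_killingCompl] at hx ⊢
    exact fun y _ => hx y trivial
  have hJK : LieIdeal.killingCompl ℂ L K ⊓ K ≤ R := by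
    rw [hRad, ← LieIdeal.solvable_iff_le_radical]
    apply LieIdeal.isSolvable_of_killingForm_apply_lie_eq_zero
    intro x hx y hy
    have hy' := LieSubmodule.lie_le_left _ _ hy
    rw [LieSubmodule.mem_inf] at hx hy'
    exact (LieIdeal.mem_killingCompl ℂ L K).1 hy'.1 x hx.2
  refine ⟨LieIdeal.killingCompl ℂ L K, hRJ, hJK, ?_⟩
  have h1 := LinearMap.BilinForm.finrank_add_finrank_orthogonal'
    (B := killingForm ℂ L) K.toSubmodule
  rw [← LieIdeal.toSubmodule_killingCompl, ← LieIdeal.coe_killingCompl_top, hker,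
    show (LieIdeal.toLieSubalgebra ℂ L R).toSubmodule = R.toSubmodule from rfl,
    inf_eq_right.2 (show R.toSubmodule ≤ K.toSubmodule from hRK)] at h1
  have h2 := Submodule.finrank_sup_add_finrank_inf_eq
    (LieIdeal.killingCompl ℂ L K).toSubmodule K.toSubmodule
  have h3 : (LieIdeal.killingCompl ℂ L K).toSubmodule ⊓ K.toSubmodule = R.toSubmodule :=
    le_antisymm hJK (le_inf hRJ hRK)
  rw [h3] at h2
  apply Submodule.eq_top_of_finrank_eq
  omega

lemma exists_dual (R J : LieIdeal ℂ L) (B : LinearMap.BilinForm ℂ L) (hs : B.IsSymm)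
    (hinv : ∀ x y z : L, B ⁅x, y⁆ z = - B y ⁅x, z⁆)
    (hRJ : R ≤ J) (hBR : ∀ r ∈ R, ∀ x, B x r = 0)
    (hnd : ∀ x ∈ J, (∀ y ∈ J, B x y = 0) → x ∈ R) (hne : ¬ J ≤ R) :
    ∃ (n : ℕ) (e f : Fin n → L), n ≠ 0 ∧ (∀ i, B (e i) (f i) = 1) ∧
    ∀ x : L, ∃ a : Fin n → Fin n → ℂ, (∀ i, ⁅x, e i⁆ - ∑ j, a i j • e j ∈ R) ∧
      (∀ i, ⁅x, f i⁆ + ∑ j, a j i • f j ∈ R) := by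
  obtain ⟨W, hW⟩ := Submodule.exists_isCompl R.toSubmodule
  let V : Submodule ℂ L := J.toSubmodule ⊓ W
  have hdec : ∀ x ∈ J, ∃ v : V, x - v ∈ R := by
    intro x hx
    have : x ∈ R.toSubmodule ⊔ W := by rw [hW.sup_eq_top]; trivial
    obtain ⟨r, hr, w, hw, rfl⟩ := Submodule.mem_sup.1 this
    refine ⟨⟨w, ?_, hw⟩, by simpa using hr⟩
    have := sub_mem hx (hRJ hr)
    simpa using this
  have hBV : (B.restrict V).Nondegenerate := by
    have hs' : (B.restrict V).IsSymm := ⟨fun x y => hs.eq _ _⟩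
    refine (LinearMap.IsRefl.nondegenerate_iff_separatingLeft hs'.isRefl).2 ?_
    intro v hv
    have : (v : L) ∈ R := by
      refine hnd _ v.2.1 fun y hy => ?_
      obtain ⟨w, hw⟩ := hdec y hy
      have h1 := hBR _ hw v
      have h2 : B v w = 0 := hv w
      rw [map_sub, h2, sub_zero] at h1
      exact h1
    have := (Submodule.disjoint_def.1 hW.disjoint) _ this v.2.2
    exact Subtype.ext this
  have hs' : (B.restrict V).IsSymm := ⟨fun x y => hs.eq _ _⟩
  let b := Module.finBasis ℂ V
  let b' := (B.restrict V).dualBasis hBV b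
  have hbb : ∀ i j, B (b i) (b' j) = if i = j then 1 else 0 := fun i j =>
    LinearMap.BilinForm.apply_dualBasis_right hBV hs' b i j
  have s1 : ∀ (c : Module.Basis (Fin (Module.finrank ℂ V)) ℂ V) (v : V),
      (v : L) = ∑ j, c.repr v j • (c j : L) := fun c v => by
    have := congrArg V.subtype (c.sum_repr v)
    rw [map_sum] at this
    exact this.symm
  refine ⟨_, fun i => b i, fun i => b' i, ?_, fun i => by rw [hbb]; simp, fun x => ?_⟩
  · intro h0
    apply hne
    have : Subsingleton V := Module.finrank_zero_iff.1 h0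
    intro x hx
    obtain ⟨v, hv⟩ := hdec x hx
    rw [Subsingleton.elim v 0] at hv
    simpa using hv
  · choose u hu using fun i => hdec ⁅x, (b i : L)⁆ (lie_mem_right ℂ L J _ _ (b i).2.1)
    choose u' hu' using fun i => hdec ⁅x, (b' i : L)⁆ (lie_mem_right ℂ L J _ _ (b' i).2.1)
    have e1 : ∀ i j, b.repr (u i) j = B ⁅x, (b i : L)⁆ (b' j) := by
      intro i j
      have h1 : B (u i) (b' j) = b.repr (u i) j := by
        rw [s1 b (u i)]
        simp [hbb]
      have h2 := hBR _ (hu i) (b' j)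
      rw [hs.eq, map_sub, LinearMap.sub_apply, sub_eq_zero] at h2
      rw [← h1, h2]
    have e2 : ∀ i j, b'.repr (u' i) j = B (b j) ⁅x, (b' i : L)⁆ := by
      intro i j
      have h1 : B (b j) (u' i) = b'.repr (u' i) j := by
        rw [s1 b' (u' i)]
        simp [hbb]
      have h2 := hBR _ (hu' i) (b j)
      rw [map_sub, sub_eq_zero] at h2
      rw [← h1, h2]
    refine ⟨fun i j => b.repr (u i) j, fun i => ?_, fun i => ?_⟩
    · have : ∑ j, b.repr (u i) j • (b j : L) = u i := (s1 b (u i)).symm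
      rw [this]; exact hu i
    · have : ∑ j, b.repr (u j) i • (b' j : L) = - u' i := by
        rw [s1 b' (u' i)]
        simp [e1, e2, hinv]
      rw [this, ← sub_eq_add_neg]; exact hu' i

end

/-- A sympathetic (perfect and complete) finite-dimensional complex Lie algebra
whose solvable radical is abelian is semisimple. -/
theorem sympathetic_abelian_radical_implies_semisimple
    (L : Type*) [LieRing L] [LieAlgebra ℂ L] [FiniteDimensional ℂ L]
    (hperf : ⁅(⊤ : LieIdeal ℂ L), (⊤ : LieIdeal ℂ L)⁆ = ⊤)
    (hcenter : LieAlgebra.center ℂ L = ⊥)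
    (hinner : ∀ D : LieDerivation ℂ L L, ∃ x : L, ∀ y : L, D y = ⁅x, y⁆)
    (habelian : IsLieAbelian (LieAlgebra.radical ℂ L)) :
    LieAlgebra.IsSemisimple ℂ L := by
  suffices h : LieAlgebra.radical ℂ L = ⊥ by
    have : HasTrivialRadical ℂ L := ⟨h⟩
    infer_instance
  by_contra hbot
  generalize hRad : LieAlgebra.radical ℂ L = R at *
  have hR : ∀ r ∈ R, ∀ s ∈ R, ⁅r, s⁆ = 0 := fun r hr s hs => by
    have := habelian.trivial ⟨r, hr⟩ ⟨s, hs⟩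
    simpa using congrArg Subtype.val this
  have hnt : Nontrivial R := (LieSubmodule.nontrivial_iff_ne_bot ℂ L L).2 hbot
  let B := LieModule.traceForm ℂ L R
  have hB0 : B ≠ 0 := by
    intro h0
    have hn := LieModule.isNilpotent_derivedSeries_of_traceForm_eq_zero (R := ℂ) (L := L) (M := R) h0
    have := LieModule.nontrivial_max_triv_of_isNilpotent ℂ (derivedSeries ℂ L 1) R
    obtain ⟨⟨m, hm⟩, hm0⟩ := exists_ne (0 : LieModule.maxTrivSubmodule ℂ (derivedSeries ℂ L 1) R)
    apply hm0
    have hc : (m : L) ∈ LieAlgebra.center ℂ L := by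
      rw [LieModule.mem_maxTrivSubmodule]
      intro x
      have hx : x ∈ derivedSeries ℂ L 1 := by
        rw [derivedSeries_def, derivedSeriesOfIdeal_succ, derivedSeriesOfIdeal_zero, hperf]
        trivial
      have := (LieModule.mem_maxTrivSubmodule ..).1 hm ⟨x, hx⟩
      exact congrArg Subtype.val this
    rw [hcenter] at hc
    have : (m : L) = 0 := hc
    apply Subtype.ext
    apply Subtype.ext
    exact this
  have hBR : ∀ r ∈ R, ∀ x, B x r = 0 := by
    intro r hr x
    have : LieModule.toEnd ℂ L R r = 0 := by
      ext s; simpa using hR r hr s s.2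
    simp [B, LieModule.traceForm_apply_apply, this]
  let K : LieIdeal ℂ L := LieAlgebra.InvariantForm.orthogonal B
    (LieModule.traceForm_lieInvariant ℂ L R) ⊤
  have hK : ∀ x, x ∈ K ↔ ∀ y, B y x = 0 := by
    intro x
    rw [LieAlgebra.InvariantForm.mem_orthogonal]; simp
  have hs : B.IsSymm := ⟨LieModule.traceForm_comm ℂ L R⟩
  obtain ⟨J, hRJ, hJK, htop⟩ := exists_J R K hRad.symm habelian
    (fun r hr => (hK r).2 (hBR r hr))
  obtain ⟨n, e, f, hn, hef, hinv⟩ := exists_dual R J B hs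
    (LieModule.traceForm_lieInvariant ℂ L R) hRJ hBR (fun x hx hxJ => by
      apply hJK
      refine ⟨hx, (hK x).2 fun y => ?_⟩
      have : y ∈ J.toSubmodule ⊔ K.toSubmodule := by rw [htop]; trivial
      obtain ⟨j, hj, k, hk, rfl⟩ := Submodule.mem_sup.1 this
      rw [hs.eq, map_add, hxJ j hj, (hK k).1 hk, add_zero]) (fun hJR => hB0 (by
      ext y x
      have : x ∈ J.toSubmodule ⊔ K.toSubmodule := by rw [htop]; trivial
      obtain ⟨j, hj, k, hk, rfl⟩ := Submodule.mem_sup.1 this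
      rw [map_add, (hK k).1 hk, hBR j (hJR hj)]; simp))
  obtain ⟨π, hπ⟩ := LinearMap.exists_leftInverse_of_injective R.toSubmodule.subtype (by simp)
  let p : L →ₗ[ℂ] L := R.toSubmodule.subtype.comp π
  have hp : ∀ x, p x ∈ R := fun x => (π x).2
  have hp' : ∀ x ∈ R, p x = x := fun x hx =>
    congrArg Subtype.val (LinearMap.congr_fun hπ ⟨x, hx⟩)
  let D : LieDerivation ℂ L L := ⟨casD e f p, casD_leibniz R hR e f hinv p hp hp'⟩
  obtain ⟨x, hx⟩ := hinner D
  have hx' : ∀ y, casD e f p y = ⁅x, y⁆ := hx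
  have hend : LieModule.toEnd ℂ L R x =
      ∑ i, LieModule.toEnd ℂ L R (e i) ∘ₗ LieModule.toEnd ℂ L R (f i) := by
    ext r
    have := hx' r
    rw [casD_apply] at this
    simp only [LinearMap.sum_apply, LinearMap.comp_apply, LieModule.toEnd_apply_apply,
      LieSubmodule.coe_bracket, ← this, AddSubmonoidClass.coe_finsetSum]
    refine Finset.sum_congr rfl fun i _ => ?_
    rw [hp' _ (lie_mem_right ℂ L R _ _ r.2), hR _ (hp _) _ r.2, sub_zero]
  have ht := trace_zero_of_perfect hperf R x
  rw [hend, map_sum] at ht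
  have : ∀ i, LinearMap.trace ℂ R
      (LieModule.toEnd ℂ L R (e i) ∘ₗ LieModule.toEnd ℂ L R (f i)) = 1 := fun i => hef i
  simp [this] at ht
  exact hn ht
end

section
/- Let g be a finite-dimensional complex Lie algebra whose solvable radical r is nonzero and abelian (r ≠ 0 and ⁅r, r⁆ = 0). Then there exists a derivation of g that is not inner; in particular, g is not complete. -/
section Aux
open LieAlgebra LieModule Module

attribute [local instance 100] LieRing.ofAssociativeRing

/-- The quotient by the radical has trivial radical. -/
lemma aux_quot_radical (L : Type*) [LieRing L] [LieAlgebra ℂ L] [FiniteDimensional ℂ L] :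
    HasTrivialRadical ℂ (L ⧸ radical ℂ L) := by
  rw [hasTrivialRadical_iff_no_abelian_ideals]
  intro I hI
  set π : L →ₗ⁅ℂ⁆ (L ⧸ radical ℂ L) :=
    { (LieSubmodule.Quotient.mk' (radical ℂ L) : L →ₗ[ℂ] L ⧸ radical ℂ L) with
      map_lie' := rfl } with hπ
  have hπ0 : ∀ x, π x = 0 ↔ x ∈ radical ℂ L := fun x => LieSubmodule.Quotient.mk_eq_zero' 
  have hs : ∀ y, ∃ x, π x = y := fun y => LieSubmodule.Quotient.surjective_mk' _ y
  have h1 : ⁅I.comap π, I.comap π⁆ ≤ radical ℂ L := by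
    rw [LieSubmodule.lieIdeal_oper_eq_span, LieSubmodule.lieSpan_le]
    rintro _ ⟨⟨a, ha⟩, ⟨b, hb⟩, rfl⟩
    have := hI.trivial ⟨π a, ha⟩ ⟨π b, hb⟩
    rw [SetLike.mem_coe, ← hπ0]
    simpa [Subtype.ext_iff] using this
  have h2 : IsSolvable (I.comap π) := by
    obtain ⟨k, hk⟩ := IsSolvable.solvable ℂ (radical ℂ L)
    rw [LieIdeal.derivedSeries_eq_bot_iff] at hk
    refine IsSolvable.mk (R := ℂ) (k := k + 1) ((LieIdeal.derivedSeries_eq_bot_iff _ _).mpr ?_)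
    rw [derivedSeriesOfIdeal_add, eq_bot_iff, ← hk]
    exact derivedSeriesOfIdeal_mono (by simpa using h1) k
  have h3 := (LieIdeal.solvable_iff_le_radical ℂ L _).mp h2
  rw [LieSubmodule.eq_bot_iff]
  intro y hy
  obtain ⟨x, rfl⟩ := hs y
  exact (hπ0 x).mpr (h3 hy)

lemma aux_image (L R : Type*) [LieRing L] [LieAlgebra ℂ L] [FiniteDimensional ℂ L]
    [LieRing R] [LieAlgebra ℂ R] (φ : L →ₗ⁅ℂ⁆ R) (hφ : Function.Surjective φ)
    (hr : ∀ x ∈ radical ℂ L, φ x = 0) : HasTrivialRadical ℂ R := by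
  rw [hasTrivialRadical_iff_no_abelian_ideals]
  intro A hA
  have := aux_quot_radical L
  set π : L →ₗ⁅ℂ⁆ (L ⧸ radical ℂ L) :=
    { (LieSubmodule.Quotient.mk' (radical ℂ L) : L →ₗ[ℂ] L ⧸ radical ℂ L) with
      map_lie' := rfl } with hπ
  have hπ0 : ∀ x, π x = 0 ↔ x ∈ radical ℂ L := fun x => LieSubmodule.Quotient.mk_eq_zero' 
  have hs : Function.Surjective π := fun y => LieSubmodule.Quotient.surjective_mk' _ y
  set I := φ.ker.map π
  have hI : ∀ y, y ∈ I ↔ ∃ x, φ x = 0 ∧ π x = y := by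
    intro y
    constructor
    · intro h
      obtain ⟨⟨x, hx⟩, h⟩ := LieIdeal.mem_map_of_surjective hs h
      exact ⟨x, by simpa using hx, h⟩
    · rintro ⟨x, hx, rfl⟩
      exact LieIdeal.mem_map (by simpa using hx)
  have hc := LieIdeal.isCompl_killingCompl I
  set J := I.killingCompl ℂ
  set A' := (A.comap φ).map π
  have hA' : ∀ y, y ∈ A' → ∃ x, φ x ∈ A ∧ π x = y := by
    intro y h
    obtain ⟨⟨x, hx⟩, h⟩ := LieIdeal.mem_map_of_surjective hs h
    exact ⟨x, by simpa using hx, h⟩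
  have hab : IsLieAbelian ↥(A' ⊓ J : LieIdeal ℂ (L ⧸ radical ℂ L)) := by
    constructor
    rintro ⟨u, hu, hu'⟩ ⟨v, hv, hv'⟩
    obtain ⟨x, hx, rfl⟩ := hA' u hu
    obtain ⟨y, hy, rfl⟩ := hA' v hv
    have h1 : ⁅π x, π y⁆ ∈ I := by
      rw [hI]
      refine ⟨⁅x, y⁆, ?_, by simp⟩
      have := hA.trivial ⟨_, hx⟩ ⟨_, hy⟩
      simpa [Subtype.ext_iff] using this
    have h2 : ⁅π x, π y⁆ ∈ J := LieSubmodule.lie_mem _ hv'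
    have h3 : ⁅π x, π y⁆ ∈ I ⊓ J := ⟨h1, h2⟩
    rw [hc.inf_eq_bot] at h3
    exact Subtype.ext (by simpa using h3)
  have h0 := HasTrivialRadical.eq_bot_of_isSolvable (R := ℂ) (A' ⊓ J)
  rw [LieSubmodule.eq_bot_iff]
  intro a ha
  obtain ⟨x, rfl⟩ := hφ a
  have : π x ∈ I ⊔ J := by rw [hc.sup_eq_top]; trivial
  obtain ⟨i, hi, j, hj, hij⟩ := LieSubmodule.mem_sup _ _ _ |>.mp this
  obtain ⟨k, hk, rfl⟩ := (hI i).mp hi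
  have hj1 : j = π (x - k) := by rw [map_sub, ← hij]; abel
  have hj2 : j ∈ A' ⊓ J := by
    refine ⟨?_, hj⟩
    rw [hj1]
    exact LieIdeal.mem_map (by simpa [hk] using ha)
  rw [h0] at hj2
  have : j = 0 := by simpa using hj2
  rw [hj1, hπ0] at this
  simpa [hk] using hr _ this

lemma aux_nondeg (W : Type*) [AddCommGroup W] [Module ℂ W] [FiniteDimensional ℂ W]
    (R : LieSubalgebra ℂ (Module.End ℂ W)) [HasTrivialRadical ℂ R] :
    (traceForm ℂ R W).Nondegenerate := by
  refine (LieModule.traceForm_isSymm ℂ R W).isRefl.nondegenerate_iff_separatingLeft.mpr ?_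
  set N : LieIdeal ℂ R := InvariantForm.orthogonal (traceForm ℂ R W)
    (traceForm_lieInvariant ℂ R W) ⊤ with hN
  suffices N = ⊥ by
    intro x hx
    have : x ∈ N := by
      rw [hN, InvariantForm.mem_orthogonal]
      intro y _
      rw [traceForm_comm, hx]
    simpa [‹N = ⊥›] using this
  have tf : traceForm ℂ N W = 0 := by
    ext ⟨x, hx⟩ ⟨y, hy⟩
    change traceForm ℂ R W x y = 0
    exact (InvariantForm.mem_orthogonal _ _ _ _).mp hy x trivial
  have nil := isNilpotent_derivedSeries_of_traceForm_eq_zero tf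
  set DN : LieIdeal ℂ R := ⁅N, N⁆ with hDN
  have hnil : LieRing.IsNilpotent DN := by
    rw [LieAlgebra.isNilpotent_iff_forall (R := ℂ)]
    rintro ⟨x, hx⟩
    apply LieSubalgebra.isNilpotent_ad_of_isNilpotent_ad (DN : LieSubalgebra ℂ R) (x := ⟨x, hx⟩)
    apply LieSubalgebra.isNilpotent_ad_of_isNilpotent_ad R (x := x)
    apply LieAlgebra.ad_nilpotent_of_nilpotent
    refine (LieModule.isNilpotent_iff_forall' (R := ℂ)).mp nil
      ⟨⟨x, LieSubmodule.lie_le_left N N hx⟩, ?_⟩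
    rwa [LieIdeal.derivedSeries_eq_derivedSeriesOfIdeal_comap, LieIdeal.mem_comap]
  have hb : DN = ⊥ := HasTrivialRadical.eq_bot_of_isSolvable (R := ℂ) DN
  have : IsLieAbelian N := by
    rw [LieSubmodule.lie_abelian_iff_lie_self_eq_bot]; exact hb
  exact HasTrivialRadical.eq_bot_of_isSolvable (R := ℂ) N

lemma aux_casimir (W : Type*) [AddCommGroup W] [Module ℂ W] [FiniteDimensional ℂ W]
    (R : LieSubalgebra ℂ (Module.End ℂ W)) [HasTrivialRadical ℂ R] :
    ∃ Ω : Module.End ℂ W, (∀ x ∈ R, x * Ω = Ω * x) ∧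
      LinearMap.trace ℂ W Ω = Module.finrank ℂ R ∧
      ∀ l : W →ₗ[ℂ] ℂ, (∀ x ∈ R, ∀ w, l (x w) = 0) → ∀ w, l (Ω w) = 0 := by
  have hB := aux_nondeg W R
  set B := traceForm ℂ R W with hBdef
  let b := Module.finBasis ℂ R
  let c := LinearMap.BilinForm.dualBasis B hB b
  have hcb : ∀ i j, B (c i) (b j) = if j = i then 1 else 0 :=
    fun i j => LinearMap.BilinForm.apply_dualBasis_left hB b i j
  have expb : ∀ z : R, z = ∑ j, B (c j) z • b j := by
    intro z
    conv_lhs => rw [← b.sum_repr z]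
    refine Finset.sum_congr rfl fun j _ => ?_
    congr 1
    conv_rhs => rw [← b.sum_repr z]
    simp only [map_sum, map_smul, hcb, smul_eq_mul, mul_ite, mul_one, mul_zero]
    simp
  have expc : ∀ z : R, z = ∑ j, B z (b j) • c j := by
    intro z
    conv_lhs => rw [← c.sum_repr z]
    refine Finset.sum_congr rfl fun j _ => ?_
    congr 1
    conv_rhs => rw [← c.sum_repr z]
    simp only [map_sum, map_smul, LinearMap.sum_apply, LinearMap.smul_apply, hcb, smul_eq_mul,
      mul_ite, mul_one, mul_zero]
    simp
  refine ⟨∑ i, (c i : Module.End ℂ W) * (b i : Module.End ℂ W), ?_, ?_, ?_⟩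
  · intro x hx
    set y : R := ⟨x, hx⟩ with hy
    have key : ∑ i, ((⁅y, c i⁆ : R) : Module.End ℂ W) * (b i : Module.End ℂ W) +
        ∑ i, (c i : Module.End ℂ W) * ((⁅y, b i⁆ : R) : Module.End ℂ W) = 0 := by
      have e1 : ∀ i, ((⁅y, c i⁆ : R) : Module.End ℂ W) =
          ∑ j, B ⁅y, c i⁆ (b j) • (c j : Module.End ℂ W) := by
        intro i
        conv_lhs => rw [expc ⁅y, c i⁆]
        simp
      have e2 : ∀ i, ((⁅y, b i⁆ : R) : Module.End ℂ W) =
          ∑ j, B (c j) ⁅y, b i⁆ • (b j : Module.End ℂ W) := by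
        intro i
        conv_lhs => rw [expb ⁅y, b i⁆]
        simp
      simp_rw [e1, e2, Finset.sum_mul, Finset.mul_sum]
      rw [Finset.sum_comm, ← Finset.sum_add_distrib]
      refine Finset.sum_eq_zero fun i _ => ?_
      rw [← Finset.sum_add_distrib]
      refine Finset.sum_eq_zero fun j _ => ?_
      rw [hBdef, traceForm_apply_lie_apply']
      simp
    have e3 : ∀ z : R, ((⁅y, z⁆ : R) : Module.End ℂ W) = x * z - z * x := fun z => rfl
    simp_rw [e3] at key
    rw [← sub_eq_zero, ← key, Finset.mul_sum, Finset.sum_mul, ← Finset.sum_sub_distrib,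
      ← Finset.sum_add_distrib]
    refine Finset.sum_congr rfl fun i _ => ?_
    noncomm_ring
  · rw [map_sum]
    have : ∀ i, LinearMap.trace ℂ W ((c i : Module.End ℂ W) * (b i : Module.End ℂ W)) = 1 := by
      intro i
      have := hcb i i
      rw [if_pos rfl] at this
      exact this
    simp [this]
  · intro l hl w
    simp only [LinearMap.sum_apply, map_sum]
    exact Finset.sum_eq_zero fun i _ => hl _ (c i).2 _

lemma aux_key (L : Type*) [LieRing L] [LieAlgebra ℂ L] [FiniteDimensional ℂ L] (n : ℕ) :
    ∀ (W : Type*) [AddCommGroup W] [Module ℂ W] [FiniteDimensional ℂ W] [LieRingModule L W]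
    [LieModule ℂ L W], Module.finrank ℂ W = n → (∀ x ∈ radical ℂ L, ∀ w : W, ⁅x, w⁆ = 0) →
    ∀ l : W →ₗ[ℂ] ℂ, (∀ (x : L) (w : W), l ⁅x, w⁆ = 0) → l ≠ 0 →
    ∃ w : W, l w ≠ 0 ∧ ∀ x : L, ⁅x, w⁆ = 0 := by
  induction n using Nat.strong_induction_on with
  | _ n ih =>
  intro W _ _ _ _ _ hn hr l hl hl0
  let ρ := toEnd ℂ L W
  have hR : HasTrivialRadical ℂ ρ.range :=
    aux_image L ρ.range ρ.rangeRestrict ρ.surjective_rangeRestrict (by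
      intro x hx
      ext w
      exact hr x hx w)
  obtain ⟨Ω, hcomm, htr, hΩ⟩ := aux_casimir W ρ.range
  have hΩl : ∀ w, l (Ω w) = 0 := by
    apply hΩ
    rintro _ ⟨x, rfl⟩ w
    exact hl x w
  have hcomm' : ∀ (x : L) (w : W), ⁅x, Ω w⁆ = Ω ⁅x, w⁆ := fun x w =>
    LinearMap.congr_fun (hcomm (ρ x) ⟨x, rfl⟩) w
  have hpow : ∀ (k : ℕ) (x : L) (w : W), ⁅x, (Ω ^ k) w⁆ = (Ω ^ k) ⁅x, w⁆ := by
    intro k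
    induction k with
    | zero => intro x w; simp
    | succ k ihk =>
      intro x w
      rw [pow_succ', Module.End.mul_apply, Module.End.mul_apply, hcomm', ihk]
  obtain ⟨k, hk⟩ := Filter.eventually_atTop.mp Ω.eventually_isCompl_ker_pow_range_pow
  have hc := hk (k + 1) (by omega)
  let W' : LieSubmodule ℂ L W :=
    { LinearMap.ker (Ω ^ (k + 1)) with
      lie_mem := by
        intro x w hw
        change (Ω ^ (k + 1)) w = 0 at hw
        change (Ω ^ (k + 1)) ⁅x, w⁆ = 0
        rw [← hpow, hw, lie_zero] }
  have hW' : W'.toSubmodule = LinearMap.ker (Ω ^ (k + 1)) := rfl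
  by_cases htop : LinearMap.ker (Ω ^ (k + 1)) = ⊤
  · have hnil : IsNilpotent Ω := ⟨k + 1, LinearMap.ker_eq_top.mp htop⟩
    have h0 := (LinearMap.isNilpotent_trace_of_isNilpotent hnil).eq_zero
    rw [htr] at h0
    have h1 : Module.finrank ℂ ρ.range = 0 := by exact_mod_cast h0
    have h2 : Subsingleton ρ.range := Module.finrank_zero_iff.mp h1
    obtain ⟨w, hw⟩ : ∃ w, l w ≠ 0 := by
      by_contra! h
      exact hl0 (LinearMap.ext h)
    refine ⟨w, hw, fun x => ?_⟩
    have : (⟨ρ x, ⟨x, rfl⟩⟩ : ρ.range) = 0 := Subsingleton.elim _ _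
    have : ρ x = 0 := congrArg Subtype.val this
    exact LinearMap.congr_fun this w
  · have hlt : Module.finrank ℂ W' < n := by
      rw [← hn]
      exact Submodule.finrank_lt htop
    obtain ⟨w, hw, hw'⟩ := ih _ hlt W' rfl (fun x hx w => Subtype.ext (hr x hx w))
      (l ∘ₗ W'.toSubmodule.subtype) (fun x w => hl x w) (by
        intro h
        apply hl0
        ext w
        have : w ∈ LinearMap.ker (Ω ^ (k + 1)) ⊔ LinearMap.range (Ω ^ (k + 1)) := by
          rw [hc.sup_eq_top]; trivial
        obtain ⟨a, ha, _, ⟨c, rfl⟩, rfl⟩ := Submodule.mem_sup.mp this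
        have h1 : l a = 0 := LinearMap.congr_fun h (⟨a, ha⟩ : W')
        rw [map_add, h1, pow_succ', Module.End.mul_apply, hΩl]
        simp)
    exact ⟨w, hw, fun x => congrArg Subtype.val (hw' x)⟩

/-- Relative version. -/
lemma aux_key' (L : Type*) [LieRing L] [LieAlgebra ℂ L] [FiniteDimensional ℂ L]
    (M : Type*) [AddCommGroup M] [Module ℂ M] [FiniteDimensional ℂ M] [LieRingModule L M]
    [LieModule ℂ L M] (W V : LieSubmodule ℂ L M)
    (hr : ∀ x ∈ radical ℂ L, ∀ w ∈ W, ⁅x, w⁆ ∈ V)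
    (l : M →ₗ[ℂ] ℂ) (hl : ∀ (x : L), ∀ w ∈ W, l ⁅x, w⁆ = 0) (hV : ∀ v ∈ V, l v = 0)
    (hl0 : ∃ w ∈ W, l w ≠ 0) :
    ∃ w ∈ W, l w ≠ 0 ∧ ∀ x : L, ⁅x, w⁆ ∈ V := by
  let V' : LieSubmodule ℂ L W := V.comap W.incl
  have hmem : ∀ w : W, w ∈ V' ↔ (w : M) ∈ V := fun w => Iff.rfl
  let l' : (W ⧸ V') →ₗ[ℂ] ℂ := V'.toSubmodule.liftQ (l ∘ₗ W.toSubmodule.subtype)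
    (fun w hw => hV _ hw)
  have hl' : ∀ w : W, l' (LieSubmodule.Quotient.mk w) = l w := fun w => rfl
  have hlie : ∀ (x : L) (w : W), ⁅x, (LieSubmodule.Quotient.mk w : W ⧸ V')⁆ =
    LieSubmodule.Quotient.mk ⁅x, w⁆ := fun x w => rfl
  have hsurj : ∀ q : W ⧸ V', ∃ w, LieSubmodule.Quotient.mk w = q :=
    fun q => LieSubmodule.Quotient.surjective_mk' _ q
  obtain ⟨q, hq, hq'⟩ := aux_key L _ (W ⧸ V') rfl (by
      intro x hx q
      obtain ⟨w, rfl⟩ := hsurj q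
      rw [hlie]
      exact LieSubmodule.Quotient.mk_eq_zero'.mpr (hr x hx w w.2)) l' (by
      intro x q
      obtain ⟨w, rfl⟩ := hsurj q
      rw [hlie, hl']
      exact hl x w w.2) (by
      intro h
      obtain ⟨w, hw, hw'⟩ := hl0
      apply hw'
      rw [← hl' ⟨w, hw⟩, h]
      rfl)
  obtain ⟨w, rfl⟩ := hsurj q
  refine ⟨w, w.2, hq, fun x => ?_⟩
  have := hq' x
  rw [hlie] at this
  have h2 : ⁅x, w⁆ ∈ V' := LieSubmodule.Quotient.mk_eq_zero'.mp this
  exact h2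

lemma aux_center (L : Type*) [LieRing L] [LieAlgebra ℂ L] [FiniteDimensional ℂ L]
    (habelian : IsLieAbelian (radical ℂ L)) (z : L) (hz0 : z ≠ 0)
    (hz : ∀ x : L, ⁅x, z⁆ = 0) :
    ∃ D : LieDerivation ℂ L L, ¬ ∃ x : L, ∀ y : L, D y = ⁅x, y⁆ := by
  have hzr : z ∈ radical ℂ L := center_le_radical ℂ L ((mem_maxTrivSubmodule ℂ L L z).mpr hz)
  let z' : radical ℂ L := ⟨z, hzr⟩
  have hz' : ∀ x : L, ⁅x, z'⁆ = 0 := fun x => Subtype.ext (hz x)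
  have hz'0 : z' ≠ 0 := fun h => hz0 (congrArg Subtype.val h)
  obtain ⟨f, hf⟩ : ∃ f : radical ℂ L →ₗ[ℂ] ℂ, f z' ≠ 0 := by
    by_contra! h
    exact hz'0 ((Module.forall_dual_apply_eq_zero_iff ℂ z').mp h)
  have hrl : ∀ (x : L), ∀ v ∈ radical ℂ L, ⁅x, v⁆ ∈ radical ℂ L :=
    fun x v hv => LieSubmodule.lie_mem _ hv
  -- an invariant functional on the radical which does not vanish at `z`
  obtain ⟨g, -, hgz, hg⟩ := aux_key' L (radical ℂ L →ₗ[ℂ] ℂ) ⊤ ⊥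
    (by
      intro x hx w _
      rw [LieSubmodule.mem_bot]
      ext v
      have : ⁅x, v⁆ = 0 := habelian.trivial ⟨x, hx⟩ v
      rw [Module.Dual.lie_apply, this]
      simp)
    (LinearMap.applyₗ z')
    (by
      intro x w _
      change ⁅x, w⁆ z' = 0
      rw [Module.Dual.lie_apply, hz', map_zero, neg_zero])
    (by
      intro v hv
      rw [LieSubmodule.mem_bot] at hv
      rw [hv, map_zero])
    ⟨f, trivial, hf⟩
  replace hgz : g z' ≠ 0 := hgz
  have hg' : ∀ (x : L) (v : radical ℂ L), g ⁅x, v⁆ = 0 := by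
    intro x v
    have h := hg x
    rw [LieSubmodule.mem_bot] at h
    have h' := LinearMap.congr_fun h v
    rw [Module.Dual.lie_apply] at h'
    simpa using h'
  let W : LieSubmodule ℂ L (L →ₗ[ℂ] ℂ) :=
    { carrier := {φ | ∃ c : ℂ, ∀ v : radical ℂ L, φ v = c * g v}
      add_mem' := by
        rintro a b ⟨c, hc⟩ ⟨d, hd⟩
        exact ⟨c + d, fun v => by simp [hc v, hd v, add_mul]⟩
      zero_mem' := ⟨0, by simp⟩
      smul_mem' := by
        rintro t a ⟨c, hc⟩
        exact ⟨t * c, fun v => by simp [hc v, mul_assoc]⟩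
      lie_mem := by
        rintro x a ⟨c, hc⟩
        refine ⟨0, fun v => ?_⟩
        have := hc ⁅x, v⁆
        rw [hg', mul_zero] at this
        rw [Module.Dual.lie_apply, ← LieSubmodule.coe_bracket, this]
        simp }
  have hW : ∀ φ, φ ∈ W ↔ ∃ c : ℂ, ∀ v : radical ℂ L, φ v = c * g v := fun φ => Iff.rfl
  obtain ⟨h, -, hhz, hh⟩ := aux_key' L (L →ₗ[ℂ] ℂ) W ⊥
    (by
      intro x hx φ hφ
      obtain ⟨c, hc⟩ := (hW φ).mp hφ
      rw [LieSubmodule.mem_bot]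
      ext y
      have := hc ⁅y, (⟨x, hx⟩ : radical ℂ L)⁆
      rw [hg', mul_zero, LieSubmodule.coe_bracket] at this
      rw [Module.Dual.lie_apply, ← lie_skew, map_neg, this]
      simp)
    (LinearMap.applyₗ z)
    (by
      intro x w _
      change ⁅x, w⁆ z = 0
      rw [Module.Dual.lie_apply, hz, map_zero, neg_zero])
    (by
      intro v hv
      rw [LieSubmodule.mem_bot] at hv
      rw [hv, map_zero])
    (by
      obtain ⟨p, hp⟩ := (radical ℂ L).toSubmodule.subtype.exists_leftInverse_of_injective
        (Submodule.ker_subtype _)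
      have hp' : ∀ v : radical ℂ L, p v = v := fun v => LinearMap.congr_fun hp v
      refine ⟨g ∘ₗ p, (hW _).mpr ⟨1, fun v => ?_⟩, ?_⟩
      · rw [LinearMap.comp_apply, hp', one_mul]
      · change g (p (z' : L)) ≠ 0
        rw [hp']
        exact hgz)
  replace hhz : h z ≠ 0 := hhz
  have hh' : ∀ x y : L, h ⁅x, y⁆ = 0 := by
    intro x y
    have h1 := hh x
    rw [LieSubmodule.mem_bot] at h1
    have h' := LinearMap.congr_fun h1 y
    rw [Module.Dual.lie_apply] at h'
    simpa using h'
  let D : LieDerivation ℂ L L :=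
    { h.smulRight z with
      leibniz' := by
        intro x y
        change h ⁅x, y⁆ • z = ⁅x, h y • z⁆ - ⁅y, h x • z⁆
        rw [hh', lie_smul, lie_smul, hz, hz]
        simp }
  have hD : ∀ x, D x = h x • z := fun x => rfl
  refine ⟨D, ?_⟩
  rintro ⟨x, hx⟩
  have := hx z
  rw [hD, hz] at this
  exact smul_ne_zero hhz hz0 this

lemma aux_centerless (L : Type*) [LieRing L] [LieAlgebra ℂ L] [FiniteDimensional ℂ L]
    (habelian : IsLieAbelian (radical ℂ L)) (hne : radical ℂ L ≠ ⊥)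
    (hz : ∀ z : L, (∀ x : L, ⁅z, x⁆ = 0) → z = 0) :
    ∃ D : LieDerivation ℂ L L, ¬ ∃ x : L, ∀ y : L, D y = ⁅x, y⁆ := by
  set r := radical ℂ L with hrdef
  have hab : ∀ x ∈ r, ∀ y ∈ r, ⁅x, y⁆ = 0 := fun x hx y hy =>
    congrArg Subtype.val (habelian.trivial ⟨x, hx⟩ ⟨y, hy⟩)
  have hrl : ∀ (x : L), ∀ v ∈ r, ⁅x, v⁆ ∈ r := fun x v hv => LieSubmodule.lie_mem _ hv
  have hrl' : ∀ v ∈ r, ∀ (x : L), ⁅v, x⁆ ∈ r := fun v hv x => by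
    rw [← lie_skew]; exact neg_mem (hrl x v hv)
  obtain ⟨v₀, hv₀, hv₀0⟩ : ∃ v ∈ r, v ≠ 0 := by
    by_contra! h
    exact hne ((LieSubmodule.eq_bot_iff _).mpr h)
  obtain ⟨f, hf⟩ : ∃ f : L →ₗ[ℂ] ℂ, f v₀ ≠ 0 := by
    by_contra! h
    exact hv₀0 ((Module.forall_dual_apply_eq_zero_iff ℂ v₀).mp h)
  let W : LieSubmodule ℂ L (L →ₗ[ℂ] L) :=
    { carrier := {φ | (∀ x, φ x ∈ r) ∧ ∃ c : ℂ, ∀ v ∈ r, φ v = c • v}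
      add_mem' := by
        rintro a b ⟨ha, c, hc⟩ ⟨hb, d, hd⟩
        exact ⟨fun x => add_mem (ha x) (hb x), c + d, fun v hv => by
          simp [hc v hv, hd v hv, add_smul]⟩
      zero_mem' := ⟨fun x => zero_mem r, 0, by simp⟩
      smul_mem' := by
        rintro t a ⟨ha, c, hc⟩
        exact ⟨fun x => r.smul_mem t (ha x), t * c, fun v hv => by
          simp [hc v hv, mul_smul]⟩
      lie_mem := by
        rintro x a ⟨ha, c, hc⟩
        refine ⟨fun y => ?_, 0, fun v hv => ?_⟩
        · rw [LieHom.lie_apply]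
          exact sub_mem (hrl _ _ (ha y)) (ha _)
        · rw [LieHom.lie_apply, hc v hv, hc _ (hrl x v hv)]
          simp }
  have hW : ∀ φ, φ ∈ W ↔ (∀ x, φ x ∈ r) ∧ ∃ c : ℂ, ∀ v ∈ r, φ v = c • v := fun φ => Iff.rfl
  let A : L →ₗ[ℂ] (L →ₗ[ℂ] L) := (ad ℂ L : L →ₗ[ℂ] (L →ₗ[ℂ] L))
  have hA : ∀ x y : L, A x y = ⁅x, y⁆ := fun x y => rfl
  have hAinj : ∀ x y, A x = A y → x = y := by
    intro x y h
    rw [← sub_eq_zero]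
    apply hz
    intro t
    rw [sub_lie, ← hA, ← hA, h, sub_self]
  have hAl : ∀ x y : L, ⁅x, A y⁆ = A ⁅x, y⁆ := by
    intro x y
    ext t
    rw [LieHom.lie_apply, hA, hA, hA, lie_lie]
  let V : LieSubmodule ℂ L (L →ₗ[ℂ] L) :=
    { r.toSubmodule.map A with
      lie_mem := by
        rintro x _ ⟨v, hv, rfl⟩
        exact ⟨⁅x, v⁆, hrl x v hv, (hAl x v).symm⟩ }
  have hV : ∀ φ, φ ∈ V ↔ ∃ v ∈ r, A v = φ := fun φ => Iff.rfl
  -- the action of the radical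
  have hrW : ∀ x ∈ r, ∀ φ ∈ W, ∀ c : ℂ, (∀ v ∈ r, φ v = c • v) → ⁅x, φ⁆ = A (-(c • x)) := by
    intro x hx φ hφ c hc
    ext t
    rw [LieHom.lie_apply, hab _ hx _ (((hW φ).mp hφ).1 t), hc _ (hrl' x hx t), hA]
    simp
  obtain ⟨φ, hφW, hφ0, hφ⟩ := aux_key' L (L →ₗ[ℂ] L) W V
    (by
      intro x hx φ hφ
      obtain ⟨c, hc⟩ := ((hW φ).mp hφ).2
      exact (hV _).mpr ⟨_, neg_mem (r.smul_mem c hx), (hrW x hx φ hφ c hc).symm⟩)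
    (f ∘ₗ LinearMap.applyₗ v₀)
    (by
      intro x φ hφ
      obtain ⟨c, hc⟩ := ((hW φ).mp hφ).2
      change f (⁅x, φ⁆ v₀) = 0
      rw [LieHom.lie_apply, hc _ hv₀, hc _ (hrl x _ hv₀)]
      simp)
    (by
      intro φ hφ
      obtain ⟨v, hv, rfl⟩ := (hV φ).mp hφ
      change f (A v v₀) = 0
      rw [hA, hab v hv _ hv₀, map_zero])
    (by
      obtain ⟨p, hp⟩ := r.toSubmodule.subtype.exists_leftInverse_of_injective
        (Submodule.ker_subtype _)
      have hp' : ∀ v (hv : v ∈ r), p v = ⟨v, hv⟩ := fun v hv =>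
        LinearMap.congr_fun hp (⟨v, hv⟩ : r.toSubmodule)
      refine ⟨r.toSubmodule.subtype ∘ₗ p, (hW _).mpr ⟨fun x => (p x).2, 1, fun v hv => ?_⟩, ?_⟩
      · simp [hp' v hv]
      · change f (p v₀ : L) ≠ 0
        rw [hp' v₀ hv₀]
        exact hf)
  obtain ⟨c, hc⟩ := ((hW φ).mp hφW).2
  have hc0 : c ≠ 0 := by
    rintro rfl
    apply hφ0
    change f (φ v₀) = 0
    rw [hc _ hv₀]
    simp
  have hex : ∀ x : L, ∃ d : L, A d = -⁅x, φ⁆ := by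
    intro x
    obtain ⟨v, hv, h⟩ := (hV _).mp (hφ x)
    exact ⟨-v, by rw [map_neg, h]⟩
  choose d hd using hex
  have hdA : ∀ x y : L, ⁅d x, y⁆ = φ ⁅x, y⁆ - ⁅x, φ y⁆ := by
    intro x y
    rw [← hA, hd, LinearMap.neg_apply, LieHom.lie_apply]
    abel
  let D₀ : L →ₗ[ℂ] L :=
    { toFun := d
      map_add' := fun x y => hAinj _ _ (by rw [map_add, hd, hd, hd, add_lie]; abel)
      map_smul' := fun t x => hAinj _ _ (by
        rw [RingHom.id_apply, map_smul, hd, hd, smul_lie, smul_neg]) }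
  let D : LieDerivation ℂ L L :=
    { D₀ with
      leibniz' := by
        intro x y
        change d ⁅x, y⁆ = ⁅x, d y⁆ - ⁅y, d x⁆
        apply hAinj
        ext t
        rw [hA, hA, sub_lie, hdA, lie_lie, lie_lie, lie_lie, hdA, hdA, lie_lie, hdA, hdA]
        simp only [map_sub, lie_sub]
        abel }
  have hD : ∀ x, D x = d x := fun x => rfl
  refine ⟨D, ?_⟩
  rintro ⟨z, hzD⟩
  have hDr : ∀ v ∈ r, ⁅z, v⁆ = c • v := by
    intro v hv
    rw [← hzD, hD]
    apply hAinj
    rw [hd, hrW v hv φ hφW c hc, map_neg, neg_neg]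
  let ρ := toEnd ℂ L r
  have hR : HasTrivialRadical ℂ ρ.range :=
    aux_image L ρ.range ρ.rangeRestrict ρ.surjective_rangeRestrict (by
      intro x hx
      ext w
      exact hab x hx _ w.2)
  have hρz : ∀ v : r, ρ z v = c • v := fun v => Subtype.ext (hDr v v.2)
  have hcen : ρ.rangeRestrict z ∈ center ℂ ρ.range := by
    rw [mem_maxTrivSubmodule]
    rintro ⟨_, ⟨y, rfl⟩⟩
    ext v
    change ((ρ y (ρ z v) - ρ z (ρ y v) : r) : L) = 0
    rw [hρz, hρz]
    simp
  rw [center_eq_bot, LieSubmodule.mem_bot] at hcen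
  have h0 : ρ z = 0 := congrArg Subtype.val hcen
  have h1 := hρz ⟨v₀, hv₀⟩
  rw [h0] at h1
  have h2 : c • v₀ = 0 := (congrArg Subtype.val h1).symm
  exact (smul_ne_zero hc0 hv₀0) h2

end Aux



/-- A finite-dimensional complex Lie algebra whose solvable radical is nonzero and
abelian admits a derivation which is not inner; in particular it is not complete. -/
theorem exists_noninner_derivation_of_abelian_radical
    (L : Type*) [LieRing L] [LieAlgebra ℂ L] [FiniteDimensional ℂ L]
    (hne : LieAlgebra.radical ℂ L ≠ ⊥)
    (habelian : IsLieAbelian (LieAlgebra.radical ℂ L)) :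
    ∃ D : LieDerivation ℂ L L, ¬ ∃ x : L, ∀ y : L, D y = ⁅x, y⁆ := by
  by_cases h : ∃ z : L, z ≠ 0 ∧ ∀ x : L, ⁅x, z⁆ = 0
  · obtain ⟨z, hz0, hz⟩ := h
    exact aux_center L habelian z hz0 hz
  · push Not at h
    refine aux_centerless L habelian hne fun z hz => ?_
    by_contra hz0
    obtain ⟨x, hx⟩ := h z hz0
    apply hx
    rw [← lie_skew, hz, neg_zero]
end

section
/- Let g be a finite-dimensional complex Lie algebra, let r be its solvable radical, and let s be a semisimple Lie subalgebra of g such that g is the internal direct sum of s and r as vector spaces. Assume r is nonzero, abelian (⁅r, r⁆ = 0), and irreducible as an s-module via the adjoint action, i.e. the only subspaces W of r satisfying ⁅s, W⁆ ⊆ W are 0 and r. Then the quotient of the space of derivations of g by the subspace of inner derivations is one-dimensional. -/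
lemma casimir_aux {U W ι : Type*} [AddCommGroup U] [Module ℂ U]
    [AddCommGroup W] [Module ℂ W] [Fintype ι] [DecidableEq ι]
    (B : LinearMap.BilinForm ℂ U) (hB : B.Nondegenerate) (hs : B.IsSymm)
    (b : Module.Basis ι ℂ U) (T : U →ₗ[ℂ] U) (hT : ∀ u w, B (T u) w = - B u (T w))
    (F : U →ₗ[ℂ] U →ₗ[ℂ] W) :
    ∑ i, (F (T (b i)) (B.dualBasis hB b i) + F (b i) (T (B.dualBasis hB b i))) = 0 := by
  set d := B.dualBasis hB b with hd
  have h1 : ∀ u, u = ∑ j, B u (b j) • d j := by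
    intro u
    conv_lhs => rw [← d.sum_repr u]
    simp [hd, LinearMap.BilinForm.dualBasis_repr_apply]
  have h2 : ∀ u, u = ∑ j, B u (d j) • b j := by
    intro u
    have : ∀ j, B u (d j) = b.repr u j := by
      intro j
      conv_lhs => rw [← b.sum_repr u]
      simp only [map_sum, map_smul, LinearMap.sum_apply, LinearMap.smul_apply, hd, LinearMap.BilinForm.apply_dualBasis_right hB hs]
      simp
    simp only [this]
    exact (b.sum_repr u).symm
  have e1 : ∀ i, F (T (b i)) (d i) = ∑ j, B (T (b i)) (d j) • F (b j) (d i) := by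
    intro i
    conv_lhs => rw [h2 (T (b i))]
    simp
  have e2 : ∀ i, F (b i) (T (d i)) = ∑ j, B (T (d i)) (b j) • F (b i) (d j) := by
    intro i
    conv_lhs => rw [h1 (T (d i))]
    simp
  rw [Finset.sum_add_distrib]
  simp only [e1, e2]
  rw [Finset.sum_comm, ← Finset.sum_add_distrib]
  refine Finset.sum_eq_zero fun i _ => ?_
  rw [← Finset.sum_add_distrib]
  refine Finset.sum_eq_zero fun j _ => ?_
  rw [hT, ← add_smul, hs.eq (b j) (T (d i)) |>.symm]
  simp

attribute [local instance 100] LieRing.ofAssociativeRing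

section
variable {S V : Type*} [LieRing S] [LieAlgebra ℂ S]
    [AddCommGroup V] [Module ℂ V] [FiniteDimensional ℂ V] [LieRingModule S V] [LieModule ℂ S V]

/-- If the trace form vanishes on an atom, the atom acts trivially. -/
lemma atom_trivial [LieAlgebra.IsSemisimple ℂ S] [LieModule.IsIrreducible ℂ S V]
    (I : LieIdeal ℂ S) (hI : IsAtom I)
    (h : ∀ x ∈ I, ∀ y ∈ I, LieModule.traceForm ℂ S V x y = 0) :
    ∀ x ∈ I, ∀ v : V, ⁅x, v⁆ = 0 := by
  have := LieModule.nontrivial_of_isIrreducible ℂ S V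
  have hII : ⁅I, I⁆ = I := lie_eq_self_of_isAtom_of_nonabelian I hI
    (LieAlgebra.IsSemisimple.non_abelian_of_isAtom I hI)
  have h0 : LieModule.traceForm ℂ I V = 0 := by
    ext ⟨x, hx⟩ ⟨y, hy⟩
    exact h x hx y hy
  have hn := LieModule.isNilpotent_derivedSeries_of_traceForm_eq_zero h0
  have htop : LieAlgebra.derivedSeries ℂ I 1 = ⊤ := by
    rw [LieIdeal.derivedSeries_eq_derivedSeriesOfIdeal_comap]
    simp [LieAlgebra.derivedSeriesOfIdeal_succ, hII]
  have hn' : LieModule.IsNilpotent I V := by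
    rw [LieModule.isNilpotent_iff_forall' (R := ℂ)] at hn ⊢
    intro x
    exact hn ⟨x, htop ▸ LieSubmodule.mem_top x⟩
  let N : LieSubmodule ℂ S V :=
    { carrier := {v | ∀ x ∈ I, ⁅x, v⁆ = 0}
      add_mem' := by
        intro a b ha hb x hx
        simp [ha x hx, hb x hx]
      zero_mem' := by intro x hx; simp
      smul_mem' := by
        intro c a ha x hx
        simp [ha x hx]
      lie_mem := by
        intro y v hv x hx
        rw [leibniz_lie, hv x hx, hv _ (lie_mem_left ℂ S I x y hx)]
        simp }
  have hnt : Nontrivial N := by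
    have := LieModule.nontrivial_max_triv_of_isNilpotent ℂ I V
    obtain ⟨⟨v, hv⟩, hv0⟩ := exists_ne (0 : LieModule.maxTrivSubmodule ℂ I V)
    refine ⟨⟨v, fun x hx => hv ⟨x, hx⟩⟩, 0, fun h => hv0 ?_⟩
    ext
    simpa using congrArg Subtype.val h
  have hN := N.eq_top_of_isIrreducible ℂ S V
  intro x hx v
  have : v ∈ N := hN ▸ LieSubmodule.mem_top v
  exact this x hx

lemma whitehead [FiniteDimensional ℂ S] [LieAlgebra.IsSemisimple ℂ S] [LieModule.IsIrreducible ℂ S V]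
    (D : LieDerivation ℂ S V) : ∃ v : V, ∀ x, D x = ⁅x, v⁆ := by
  classical
  by_cases htriv : ∀ I : LieIdeal ℂ S, IsAtom I → ∀ x ∈ I, ∀ v : V, ⁅x, v⁆ = 0
  · have hker : (LieModule.toEnd ℂ S V).ker = ⊤ := by
      rw [eq_top_iff, ← LieAlgebra.IsSemisimple.sSup_atoms_eq_top]
      refine sSup_le fun I hI x hx => ?_
      rw [LieHom.mem_ker]
      ext v
      exact htriv I hI x hx v
    have hz : ∀ (x : S) (v : V), ⁅x, v⁆ = 0 := by
      intro x v
      have : x ∈ (LieModule.toEnd ℂ S V).ker := hker ▸ LieSubmodule.mem_top x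
      rw [LieHom.mem_ker] at this
      exact congrArg (fun f => f v) this
    have hD : ∀ x y : S, D ⁅x, y⁆ = 0 := by
      intro x y
      simp [LieDerivation.apply_lie_eq_sub, hz]
    let J : LieIdeal ℂ S :=
      { (D : S →ₗ[ℂ] V).ker with
        lie_mem := by
          intro x y _
          exact hD x y }
    have hJ : J = ⊤ := by
      rw [eq_top_iff, ← LieAlgebra.IsSemisimple.sSup_atoms_eq_top]
      refine sSup_le fun I hI => ?_
      have hII : ⁅I, I⁆ = I := lie_eq_self_of_isAtom_of_nonabelian I hI
        (LieAlgebra.IsSemisimple.non_abelian_of_isAtom I hI)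
      rw [← hII, LieSubmodule.lieIdeal_oper_eq_span, LieSubmodule.lieSpan_le]
      rintro _ ⟨x, y, rfl⟩
      exact hD _ _
    refine ⟨0, fun x => ?_⟩
    have : x ∈ J := hJ ▸ LieSubmodule.mem_top x
    rw [lie_zero]
    exact this
  · push Not at htriv
    obtain ⟨I, hI, x₀, hx₀, v₀, hv₀⟩ := htriv
    set B : LinearMap.BilinForm ℂ I := LieModule.traceForm ℂ I V with hBdef
    have hBs : B.IsSymm := ⟨fun x y => LieModule.traceForm_comm ℂ I V x y⟩
    have hBS : ∀ u w : I, B u w = LieModule.traceForm ℂ S V u w := fun _ _ => rfl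
    have hinv := LieModule.traceForm_lieInvariant ℂ S V
    have hB : B.Nondegenerate := by
      let J : LieIdeal ℂ S := I ⊓ LieAlgebra.InvariantForm.orthogonal _ hinv I
      have hJ : J = ⊥ := by
        rcases hI.le_iff.mp (inf_le_left : J ≤ I) with h | h
        · exact h
        · exfalso
          apply hv₀
          refine atom_trivial I hI ?_ x₀ hx₀ v₀
          intro x hx y hy
          have : y ∈ J := h.symm.le hy
          exact (LieAlgebra.InvariantForm.mem_orthogonal _ hinv I y).mp this.2 x hx
      have key : ∀ y : I, (∀ x : I, B x y = 0) → y = 0 := by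
        intro y hy
        have : (y : S) ∈ J := ⟨y.2, (LieAlgebra.InvariantForm.mem_orthogonal _ hinv I y).mpr
          fun x hx => hy ⟨x, hx⟩⟩
        rw [hJ] at this
        ext
        simpa using this
      refine ⟨fun y hy => key y fun x => ?_, key⟩
      rw [← hBs.eq]
      exact hy x
    let b := Module.finBasis ℂ I
    let d := B.dualBasis hB b
    have cas : ∀ {W : Type _} [AddCommGroup W] [Module ℂ W] (x : S)
        (F : I →ₗ[ℂ] I →ₗ[ℂ] W), ∑ i, (F ⁅x, b i⁆ (d i) + F (b i) ⁅x, d i⁆) = 0 := by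
      intro W _ _ x F
      refine casimir_aux B hB hBs b (LieModule.toEnd ℂ S I x) ?_ F
      intro u w
      exact hinv x u w
    let ρ := LieModule.toEnd ℂ S V
    let C : Module.End ℂ V := ∑ i, ρ (b i) * ρ (d i)
    have hC : ∀ v, C v = ∑ i, ⁅(b i : S), ⁅(d i : S), v⁆⁆ := by
      intro v
      simp [C, ρ, LinearMap.sum_apply]
    -- the basic identity
    have main : ∀ (E : S →ₗ[ℂ] V) (x : S),
        ∑ i, (⁅(⁅x, b i⁆ : I).1, E (d i)⁆ + ⁅(b i : S), E (⁅x, d i⁆ : I).1⁆) = 0 := by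
      intro E x
      exact cas x (((ρ : S →ₗ[ℂ] Module.End ℂ V).domRestrict I.toSubmodule).compl₂
        (E.domRestrict I.toSubmodule))
    have hCcomm : ∀ (x : S) (v : V), C ⁅x, v⁆ = ⁅x, C v⁆ := by
      intro x v
      have := main ((ρ : S →ₗ[ℂ] Module.End ℂ V).flip v) x
      rw [hC, hC, lie_sum, ← sub_eq_zero, ← neg_eq_zero, neg_sub,
        ← Finset.sum_sub_distrib, ← this]
      refine Finset.sum_congr rfl fun i _ => ?_
      change _ = ⁅⁅x, (b i : S)⁆, ⁅(d i : S), v⁆⁆ + ⁅(b i : S), ⁅⁅x, (d i : S)⁆, v⁆⁆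
      rw [leibniz_lie x (b i : S), leibniz_lie x (d i : S), lie_add]
      abel
    have htr : LinearMap.trace ℂ V C ≠ 0 := by
      have h1 : LinearMap.trace ℂ V C = (Module.finrank ℂ I : ℂ) := by
        have : ∀ i, LinearMap.trace ℂ V (ρ (b i) * ρ (d i)) = 1 := by
          intro i
          change B (b i) (d i) = 1
          simp [d, LinearMap.BilinForm.apply_dualBasis_right hB hBs]
        simp [C, map_sum, this]
      rw [h1, Nat.cast_ne_zero]
      intro h0
      have := Module.finrank_zero_iff.mp h0
      have h2 : (⟨x₀, hx₀⟩ : I) = 0 := Subsingleton.elim _ _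
      apply hv₀
      have h3 : x₀ = 0 := congrArg Subtype.val h2
      simp [h3]
    let N : LieSubmodule ℂ S V :=
      { C.ker with
        lie_mem := by
          intro x v hv
          change C v = 0 at hv
          change C ⁅x, v⁆ = 0
          rw [hCcomm, hv, lie_zero] }
    have hN : N = ⊥ := by
      rcases IsSimpleOrder.eq_bot_or_eq_top N with h | h
      · exact h
      · exfalso
        apply htr
        have : C = 0 := by
          ext v
          have : v ∈ N := h ▸ LieSubmodule.mem_top v
          exact this
        simp [this]
    have hker : C.ker = ⊥ := by
      rw [Submodule.eq_bot_iff]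
      intro v hv
      have : v ∈ N := hv
      rw [hN] at this
      simpa using this
    have hinj : Function.Injective C := LinearMap.ker_eq_bot.mp hker
    have hsurj : Function.Surjective C := LinearMap.injective_iff_surjective.mp hinj
    obtain ⟨v, hv⟩ := hsurj (∑ i, ⁅(b i : S), D (d i)⁆)
    refine ⟨v, fun x => hinj ?_⟩
    rw [hCcomm, hv, hC, lie_sum, ← sub_eq_zero, ← neg_eq_zero, neg_sub,
        ← Finset.sum_sub_distrib, ← main (D : S →ₗ[ℂ] V) x]
    refine Finset.sum_congr rfl fun i _ => ?_
    change _ = ⁅⁅x, (b i : S)⁆, D (d i : S)⁆ + ⁅(b i : S), D ⁅x, (d i : S)⁆⁆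
    rw [leibniz_lie x (b i : S), LieDerivation.apply_lie_eq_sub, lie_sub]
    abel
end

/-- Let `g` be a finite-dimensional complex Lie algebra with solvable radical `r`,
and let `s` be a semisimple subalgebra with `g = s ⊕ r` as vector spaces. If `r` is
nonzero, abelian, and irreducible as an `s`-module under the adjoint action, then
`Der(g)/ad(g)` is one-dimensional. -/
theorem outer_derivations_one_dimensional
    (L : Type*) [LieRing L] [LieAlgebra ℂ L] [FiniteDimensional ℂ L]
    (s : LieSubalgebra ℂ L) [LieAlgebra.IsSemisimple ℂ s]
    (hinf : s.toSubmodule ⊓ (LieAlgebra.radical ℂ L : Submodule ℂ L) = ⊥)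
    (hsup : s.toSubmodule ⊔ (LieAlgebra.radical ℂ L : Submodule ℂ L) = ⊤)
    (hne : LieAlgebra.radical ℂ L ≠ ⊥)
    (habelian : IsLieAbelian (LieAlgebra.radical ℂ L))
    (hirred : ∀ W : Submodule ℂ L, W ≤ (LieAlgebra.radical ℂ L : Submodule ℂ L) →
      (∀ x ∈ s, ∀ w ∈ W, ⁅x, w⁆ ∈ W) →
      W = ⊥ ∨ W = (LieAlgebra.radical ℂ L : Submodule ℂ L)) :
    Module.finrank ℂ
      (LieDerivation ℂ L L ⧸ LinearMap.range (LieDerivation.ad ℂ L).toLinearMap) = 1 := by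
  generalize LieAlgebra.radical ℂ L = r at *
  have hc : IsCompl s.toSubmodule r.toSubmodule := ⟨disjoint_iff.mpr hinf, codisjoint_iff.mpr hsup⟩
  have habel : ∀ u ∈ r, ∀ w ∈ r, ⁅u, w⁆ = 0 := by
    intro u hu w hw
    have := habelian.trivial ⟨u, hu⟩ ⟨w, hw⟩
    exact congrArg Subtype.val this
  have hnt : Nontrivial r := (LieSubmodule.nontrivial_iff_ne_bot ℂ L L).mpr hne
  have hirr : LieModule.IsIrreducible ℂ s r := by
    refine LieModule.IsIrreducible.mk fun N hN => ?_
    rcases hirred (N.toSubmodule.map r.toSubmodule.subtype) (Submodule.map_subtype_le _ _) (by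
      rintro x hx _ ⟨w, hw, rfl⟩
      exact ⟨(⁅(⟨x, hx⟩ : s), (w : r)⁆ : r), N.lie_mem hw, rfl⟩) with h | h
    · exfalso
      apply hN
      rw [← LieSubmodule.toSubmodule_eq_bot]
      rw [Submodule.eq_bot_iff]
      intro w hw
      have h1 : (w : L) ∈ N.toSubmodule.map r.toSubmodule.subtype := ⟨w, hw, rfl⟩
      rw [h] at h1
      exact Subtype.ext (by simpa using h1)
    · rw [eq_top_iff]
      intro w _
      have : (w : L) ∈ N.toSubmodule.map r.toSubmodule.subtype := h.symm ▸ w.2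
      obtain ⟨w', hw', e⟩ := this
      have : w' = w := Subtype.ext e
      exact this ▸ hw'
  obtain ⟨pS, pR, hdec, hSs, hSr, hRs, hRr⟩ : ∃ (pS : L →ₗ[ℂ] s) (pR : L →ₗ[ℂ] r),
      (∀ x, (pS x : L) + pR x = x) ∧ (∀ x : s, pS x = x) ∧ (∀ x ∈ r, pS x = 0) ∧
      (∀ x ∈ s, pR x = 0) ∧ (∀ x : r, pR x = x) := by
    refine ⟨s.toSubmodule.projectionOnto r.toSubmodule hc,
      r.toSubmodule.projectionOnto s.toSubmodule hc.symm, ?_, ?_, ?_, ?_, ?_⟩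
    · intro x
      have hx : x ∈ s.toSubmodule ⊔ r.toSubmodule := hc.sup_eq_top ▸ Submodule.mem_top
      obtain ⟨a, ha, b, hb, rfl⟩ := Submodule.mem_sup.mp hx
      rw [map_add, map_add]
      have h1 := Submodule.projectionOnto_apply_left hc ⟨a, ha⟩
      have h2 := Submodule.projectionOnto_apply_right hc ⟨b, hb⟩
      have h3 := Submodule.projectionOnto_apply_left hc.symm ⟨b, hb⟩
      have h4 := Submodule.projectionOnto_apply_right hc.symm ⟨a, ha⟩
      simp only at h1 h2 h3 h4
      rw [h1, h2, h3, h4]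
      simp
    · intro x
      exact Submodule.projectionOnto_apply_left hc x
    · intro x hx
      exact Submodule.projectionOnto_apply_right hc ⟨x, hx⟩
    · intro x hx
      exact Submodule.projectionOnto_apply_right hc.symm ⟨x, hx⟩
    · intro x
      exact Submodule.projectionOnto_apply_left hc.symm x
  have rl : ∀ x : L, ∀ v ∈ r, ⁅x, v⁆ ∈ r := fun x v hv => r.lie_mem hv
  have rr : ∀ x : L, ∀ v ∈ r, ⁅v, x⁆ ∈ r := fun x v hv => lie_mem_left ℂ L r v x hv
  have pSlie : ∀ x y : L, pS ⁅x, y⁆ = ⁅pS x, pS y⁆ := by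
    intro x y
    conv_lhs => rw [← hdec x, ← hdec y]
    rw [add_lie, lie_add, map_add, map_add, hSr _ (rr _ _ (pR x).2), hSr _ (rl _ _ (pR y).2)]
    simpa using hSs ⁅pS x, pS y⁆
  have pRlie : ∀ (x : s) (y : L), pR ⁅(x : L), y⁆ = ⁅x, pR y⁆ := by
    intro x y
    conv_lhs => rw [← hdec y]
    rw [lie_add, map_add, hRs _ (s.lie_mem x.2 (pS y).2), zero_add]
    exact hRr ⁅x, pR y⁆
  have : LieAlgebra.HasTrivialRadical ℂ s := inferInstance
  have noab := LieAlgebra.hasTrivialRadical_iff_no_abelian_ideals (R := ℂ) (L := s) |>.mp this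
  -- derivations preserve `r`
  have pres : ∀ (D : LieDerivation ℂ L L), ∀ v ∈ r, pS (D v) = 0 := by
    intro D
    let J : LieIdeal ℂ s :=
      { r.toSubmodule.map (pS ∘ₗ (D : L →ₗ[ℂ] L)) with
        lie_mem := by
          rintro x _ ⟨v, hv, rfl⟩
          refine ⟨⁅(x : L), v⁆, rl _ _ hv, ?_⟩
          change pS (D ⁅(x : L), v⁆) = ⁅x, pS (D v)⁆
          rw [LieDerivation.apply_lie_eq_add, map_add, pSlie, pSlie, hSr v hv, hSs]
          simp }
    have key : ∀ v ∈ r, ∀ w ∈ r, ⁅pS (D v), pS (D w)⁆ = 0 := by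
      have h1 : ∀ v ∈ r, ∀ w ∈ r, pS (D ⁅D v, w⁆) = ⁅pS (D v), pS (D w)⁆ := by
        intro v hv w hw
        rw [LieDerivation.apply_lie_eq_add, map_add, pSlie, pSlie, hSr w hw]
        simp
      intro v hv w hw
      have h2 : ⁅D v, w⁆ = ⁅D w, v⁆ := by
        have h3 := LieDerivation.apply_lie_eq_add D v w
        rw [habel v hv w hw, map_zero, ← lie_skew v (D w)] at h3
        rw [← sub_eq_zero, h3]
        abel
      have h4 : ⁅pS (D v), pS (D w)⁆ = - ⁅pS (D v), pS (D w)⁆ := by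
        rw [lie_skew, ← h1 v hv w hw, h2, h1 w hw v hv]
      have h5 : (2 : ℂ) • ⁅pS (D v), pS (D w)⁆ = 0 := by
        rw [two_smul]
        nth_rewrite 1 [h4]
        abel
      exact (smul_eq_zero.mp h5).resolve_left two_ne_zero
    have hJ : J = ⊥ := by
      apply noab
      refine ⟨?_⟩
      rintro ⟨_, v, hv, rfl⟩ ⟨_, w, hw, rfl⟩
      exact Subtype.ext (key v hv w hw)
    intro v hv
    have : pS (D v) ∈ J := ⟨v, hv, rfl⟩
    rw [hJ] at this
    simpa using this
  -- the outer derivation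
  let D₀ : LieDerivation ℂ L L :=
    { toLinearMap := r.toSubmodule.subtype ∘ₗ pR
      leibniz' := by
        intro x y
        change ((pR ⁅x, y⁆ : r) : L) = ⁅x, (pR y : L)⁆ - ⁅y, (pR x : L)⁆
        have e1 : ⁅x, (pR y : L)⁆ = ⁅(pS x : L), (pR y : L)⁆ := by
          conv_lhs => rw [← hdec x]
          rw [add_lie, habel _ (pR x).2 _ (pR y).2, add_zero]
        have e2 : pR ⁅(pR x : L), y⁆ = (⟨⁅(pR x : L), y⁆, rr _ _ (pR x).2⟩ : r) :=
          hRr ⟨⁅(pR x : L), y⁆, rr _ _ (pR x).2⟩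
        conv_lhs => rw [← hdec x]
        rw [add_lie, map_add, pRlie, e2, e1, ← lie_skew y (pR x : L), sub_neg_eq_add]
        rfl }
  have hD₀ : ∀ x, D₀ x = pR x := fun x => rfl
  refine finrank_eq_one (Submodule.Quotient.mk D₀) ?_ ?_
  · rw [Ne, Submodule.Quotient.mk_eq_zero]
    rintro ⟨z, hz⟩
    have hz' : ∀ x, ⁅z, x⁆ = pR x := fun x => by
      rw [← hD₀ x, ← hz]; simp
    have hcen : pS z = 0 := by
      have hcz : pS z ∈ LieAlgebra.center ℂ s := by
        rw [LieModule.mem_maxTrivSubmodule]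
        intro x
        have h1 := hz' x
        rw [hRs _ x.2] at h1
        have h2 := pSlie z x
        rw [h1, hSs] at h2
        rw [← lie_skew, ← h2]
        simp
      rw [LieAlgebra.center_eq_bot] at hcz
      simpa using hcz
    obtain ⟨v, hv⟩ := exists_ne (0 : r)
    apply hv
    have h1 := hz' v
    rw [hRr] at h1
    rw [← hdec z, hcen] at h1
    have h2 := habel _ (pR z).2 _ v.2
    ext
    rw [← h1]
    simpa using h2
  · intro q
    obtain ⟨D, rfl⟩ := Submodule.Quotient.mk_surjective _ q
    let α : LieDerivation ℂ s s :=
      { toLinearMap := pS ∘ₗ (D : L →ₗ[ℂ] L) ∘ₗ s.toSubmodule.subtype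
        leibniz' := by
          intro x y
          change pS (D ⁅(x : L), (y : L)⁆) = ⁅x, pS (D y)⁆ - ⁅y, pS (D x)⁆
          rw [LieDerivation.apply_lie_eq_sub, map_sub, pSlie, pSlie, hSs, hSs] }
    let β : LieDerivation ℂ s r :=
      { toLinearMap := pR ∘ₗ (D : L →ₗ[ℂ] L) ∘ₗ s.toSubmodule.subtype
        leibniz' := by
          intro x y
          change pR (D ⁅(x : L), (y : L)⁆) = ⁅x, pR (D y)⁆ - ⁅y, pR (D x)⁆
          rw [LieDerivation.apply_lie_eq_sub, map_sub, pRlie, pRlie] }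
    obtain ⟨y, hy⟩ := LieDerivation.IsKilling.exists_eq_ad α
    obtain ⟨v, hv⟩ := whitehead β
    have hy' : ∀ x : s, pS (D x) = ⁅y, x⁆ := fun x => by
      change α x = _
      rw [← hy]; simp
    have hv' : ∀ x : s, pR (D x) = ⁅x, v⁆ := hv
    let z : L := (y : L) - v
    let D' : LieDerivation ℂ L L := D - LieDerivation.ad ℂ L z
    have hD' : ∀ x, D' x = D x - ⁅z, x⁆ := fun x => by simp [D']
    have hD's : ∀ x : s, D' x = 0 := by
      intro x
      rw [hD', ← hdec (D x), hy', hv']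
      change ⁅(y : L), (x : L)⁆ + ⁅(x : L), (v : L)⁆ - ⁅(y : L) - v, (x : L)⁆ = 0
      rw [sub_lie, ← lie_skew (x : L) (v : L)]
      abel
    have hD'r : ∀ w ∈ r, D' w ∈ r := by
      intro w hw
      rw [← hdec (D' w), pres D' w hw]
      simp
    let f : Module.End ℂ r := (D' : L →ₗ[ℂ] L).restrict (p := r.toSubmodule) (q := r.toSubmodule) hD'r
    have hf : ∀ w : r, (f w : L) = D' w := fun w => rfl
    obtain ⟨c, hc⟩ := Module.End.exists_eigenvalue f
    let N : LieSubmodule ℂ s r :=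
      { f.eigenspace c with
        lie_mem := by
          intro x w hw
          change w ∈ f.eigenspace c at hw
          change ⁅x, w⁆ ∈ f.eigenspace c
          rw [Module.End.mem_eigenspace_iff] at hw ⊢
          ext
          rw [hf]
          change D' ⁅(x : L), (w : L)⁆ = ((c • ⁅x, w⁆ : r) : L)
          rw [LieDerivation.apply_lie_eq_sub, hD's, lie_zero, sub_zero, ← hf, hw, ← lie_smul]
          rfl }
    have hN : N = ⊤ := by
      rcases IsSimpleOrder.eq_bot_or_eq_top N with h | h
      · exfalso
        apply hc
        rw [← LieSubmodule.toSubmodule_eq_bot] at h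
        exact h
      · exact h
    have hfc : ∀ w : r, D' w = c • (w : L) := by
      intro w
      have : w ∈ N := hN ▸ LieSubmodule.mem_top w
      have : w ∈ f.eigenspace c := this
      rw [Module.End.mem_eigenspace_iff] at this
      rw [← hf, this]
      rfl
    refine ⟨c, ?_⟩
    rw [← Submodule.Quotient.mk_smul, Submodule.Quotient.eq]
    refine ⟨-z, ?_⟩
    ext x
    have h1 : D' x = c • (pR x : L) := by
      conv_lhs => rw [← hdec x]
      rw [map_add, hD's, hfc, zero_add]
    rw [hD'] at h1
    change (LieDerivation.ad ℂ L (-z)) x = c • D₀ x - D x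
    rw [hD₀, ← h1]
    simp
end
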